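/- Let d be a positive integer, let K be a field, and let E be an unmixed uniform admissible clutter of height g = 4 in the standard model (a set of monotone functions f : Fin d → Fin 4 containing all constant functions, such that every minimal vertex cover has cardinality 4). Then the Alexander dual ideal I(𝒞)^∨ in MvPolynomial ((Fin 4) × (Fin d)) K, generated by the squarefree monomials ∏_{v ∈ C} X_v as C ranges over the minimal vertex covers, has linear quotients if and only if the clutter does not satisfy condition (*). -/

import Mathlib

/-- A subset `C` of the vertex set `(Fin g) × (Fin d)` is a vertex cover of the
clutter given by the edge set `E` if it meets every edge. -/
def IsCover {g d : ℕ} (E : Set (Fin d → Fin g)) (C : Finset (Fin g × Fin d)) : Prop :=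
  ∀ f ∈ E, ∃ i : Fin d, (f i, i) ∈ C

/-- A minimal vertex cover: a vertex cover no proper subset of which is a vertex cover. -/
def IsMinCover {g d : ℕ} (E : Set (Fin d → Fin g)) (C : Finset (Fin g × Fin d)) : Prop :=
  IsCover E C ∧ ∀ C' ⊂ C, ¬ IsCover E C'

/-- The size-4 vertex cover `{x_1^a, x_2^b, x_3^c, x_4^e}` associated to a 4-tuple
`(a, b, c, e)` of colors. -/
def TupleCover {d : ℕ} (a b c e : Fin d) : Finset (Fin 4 × Fin d) :=
  {((0 : Fin 4), a), ((1 : Fin 4), b), ((2 : Fin 4), c), ((3 : Fin 4), e)}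

/-- Condition (*): there exist size-4 vertex covers `(a, b, c, e)` and `(a, s, t, e)`,
sharing the first and last entries, such that neither `(a, b, t, e)` nor
`(a, s, c, e)` is a vertex cover. -/
def CondStar {d : ℕ} (E : Set (Fin d → Fin 4)) : Prop :=
  ∃ a b c e s t : Fin d,
    IsCover E (TupleCover a b c e) ∧ IsCover E (TupleCover a s t e) ∧
    ¬ IsCover E (TupleCover a b t e) ∧ ¬ IsCover E (TupleCover a s c e)

/-- The squarefree monomial `∏_{v ∈ C} X_v` associated to a set of vertices `C`. -/
noncomputable def CoverMonomial (K : Type*) [CommRing K] {g d : ℕ}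
    (C : Finset (Fin g × Fin d)) : MvPolynomial (Fin g × Fin d) K :=
  ∏ v ∈ C, MvPolynomial.X v

/-- A (finite) set `G` of monomials, generating a monomial ideal in a single degree,
has linear quotients if its elements can be enumerated as `u_1, …, u_r` so that for
each `i ≥ 1` the colon ideal `((u_1, …, u_i) : u_{i+1})` is generated by variables. -/
def HasLinearQuotients {V K : Type*} [CommRing K]
    (G : Set (MvPolynomial V K)) : Prop :=
  ∃ L : List (MvPolynomial V K), L.Nodup ∧ {u | u ∈ L} = G ∧
    ∀ i : ℕ, ∀ hi : i < L.length, 0 < i →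
      ∃ S : Set V,
        Submodule.colon (Ideal.span {u | u ∈ L.take i}) (Ideal.span {L.get ⟨i, hi⟩}) =
          Ideal.span (MvPolynomial.X '' S)

section Monomials

variable {K : Type*} [Field K] {g d : ℕ}

/-- The exponent vector of `CoverMonomial K C`. -/
noncomputable def coverExponent (C : Finset (Fin g × Fin d)) : Fin g × Fin d →₀ ℕ :=
  ∑ v ∈ C, Finsupp.single v 1

lemma coverExponent_apply (C : Finset (Fin g × Fin d)) (v : Fin g × Fin d) :
    coverExponent C v = if v ∈ C then 1 else 0 := by
  simp [coverExponent, Finsupp.finsetSum_apply, Finsupp.single_apply]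

lemma coverMonomial_eq_monomial (C : Finset (Fin g × Fin d)) :
    CoverMonomial K C = MvPolynomial.monomial (coverExponent C) 1 := by
  rw [CoverMonomial, coverExponent, MvPolynomial.monomial_sum_one]
  rfl

lemma coverMonomial_injective :
    Function.Injective (CoverMonomial K : Finset (Fin g × Fin d) → _) := by
  intro C D h
  rw [coverMonomial_eq_monomial, coverMonomial_eq_monomial] at h
  have h := MvPolynomial.monomial_left_injective (one_ne_zero) h
  ext v
  have := DFunLike.congr_fun h v
  simp only [coverExponent_apply] at this
  split_ifs at this <;> simp_all

lemma coverExponent_le_iff (C D : Finset (Fin g × Fin d)) (m : Fin g × Fin d →₀ ℕ) :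
    coverExponent D ≤ m + coverExponent C ↔ ∀ v ∈ D, v ∉ C → m v ≠ 0 := by
  rw [Finsupp.le_def]
  refine forall_congr' fun v => ?_
  rw [Finsupp.add_apply, coverExponent_apply, coverExponent_apply]
  by_cases hD : v ∈ D <;> by_cases hC : v ∈ C <;> simp [hD, hC, Nat.one_le_iff_ne_zero]

lemma mem_colon_coverMonomial_iff (A : Set (Finset (Fin g × Fin d))) (C : Finset (Fin g × Fin d))
    (p : MvPolynomial (Fin g × Fin d) K) :
    p ∈ Submodule.colon (Ideal.span (CoverMonomial K '' A)) (Ideal.span {CoverMonomial K C}) ↔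
      ∀ m ∈ p.support, ∃ D ∈ A, ∀ v ∈ D, v ∉ C → m v ≠ 0 := by
  have hA : CoverMonomial K '' A =
      (fun s => MvPolynomial.monomial s (1 : K)) '' (coverExponent '' A) := by
    rw [Set.image_image]
    exact Set.image_congr fun D _ => coverMonomial_eq_monomial D
  rw [Ideal.mem_colon_span_singleton, hA, MvPolynomial.mem_ideal_span_monomial_image,
    coverMonomial_eq_monomial]
  simp only [Set.exists_mem_image, ← coverExponent_le_iff]
  constructor
  · intro h m hm
    refine h _ ?_
    rw [MvPolynomial.mem_support_iff] at hm ⊢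
    rwa [MvPolynomial.coeff_mul_monomial, mul_one]
  · intro h m hm
    rw [MvPolynomial.mem_support_iff, MvPolynomial.coeff_mul_monomial'] at hm
    split_ifs at hm with hle
    · obtain ⟨D, hD, hDm⟩ := h (m - coverExponent C) (by simpa using hm)
      exact ⟨D, hD, by rwa [tsub_add_cancel_of_le hle] at hDm⟩
    · exact absurd rfl hm

/-- A colon ideal of squarefree monomials is generated by variables exactly when the
exchange property holds. -/
lemma colon_eq_span_X_iff (A : Set (Finset (Fin g × Fin d))) (C : Finset (Fin g × Fin d)) :
    (∃ S : Set (Fin g × Fin d),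
      Submodule.colon (Ideal.span (CoverMonomial K '' A)) (Ideal.span {CoverMonomial K C}) =
        Ideal.span (MvPolynomial.X '' S)) ↔
      ∀ D ∈ A, ∃ D' ∈ A, ∃ v ∈ D, v ∉ C ∧ D' ⊆ insert v C := by
  classical
  have hX (v : Fin g × Fin d) : (MvPolynomial.X v : MvPolynomial _ K) ∈ Submodule.colon
      (Ideal.span (CoverMonomial K '' A)) (Ideal.span {CoverMonomial K C}) ↔
        ∃ D ∈ A, D ⊆ insert v C := by
    rw [mem_colon_coverMonomial_iff, MvPolynomial.support_X]
    simp only [Finset.mem_singleton, forall_eq]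
    refine exists_congr fun D => and_congr_right fun _ => forall_congr' fun w => ?_
    rw [Finset.mem_insert]
    by_cases hw : v = w <;> simp [hw, eq_comm (a := w), or_iff_not_imp_left]
  constructor
  · rintro ⟨S, hS⟩ D hD
    have hmem : (CoverMonomial K (D \ C)) ∈ Submodule.colon
        (Ideal.span (CoverMonomial K '' A)) (Ideal.span {CoverMonomial K C}) := by
      rw [mem_colon_coverMonomial_iff, coverMonomial_eq_monomial]
      intro m hm
      rw [Finset.mem_singleton.1 (MvPolynomial.support_monomial_subset hm)]
      exact ⟨D, hD, fun v hv hC => by simp [coverExponent_apply, hv, hC]⟩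
    rw [hS, coverMonomial_eq_monomial, MvPolynomial.mem_ideal_span_X_image] at hmem
    obtain ⟨v, hvS, hv⟩ := hmem (coverExponent (D \ C)) (by simp)
    have hv : v ∈ D ∧ v ∉ C := by simpa [coverExponent_apply] using hv
    obtain ⟨D', hD', hsub⟩ :=
      (hX v).1 (hS ▸ Ideal.subset_span (Set.mem_image_of_mem _ hvS))
    exact ⟨D', hD', v, hv.1, hv.2, hsub⟩
  · intro h
    refine ⟨{v | ∃ D ∈ A, D ⊆ insert v C}, le_antisymm (fun p hp => ?_) ?_⟩
    · rw [mem_colon_coverMonomial_iff] at hp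
      rw [MvPolynomial.mem_ideal_span_X_image]
      intro m hm
      obtain ⟨D, hD, hDm⟩ := hp m hm
      obtain ⟨D', hD', v, hvD, hvC, hsub⟩ := h D hD
      exact ⟨v, ⟨D', hD', hsub⟩, hDm v hvD hvC⟩
    · rw [Ideal.span_le]
      rintro _ ⟨v, hv, rfl⟩
      exact (hX v).2 hv

/-- Any two generators of an ideal with linear quotients satisfy an exchange property, in one
of the two directions. -/
lemma HasLinearQuotients.exists_exchange {A : Set (Finset (Fin g × Fin d))}
    (h : HasLinearQuotients (CoverMonomial K '' A)) {C D : Finset (Fin g × Fin d)}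
    (hC : C ∈ A) (hD : D ∈ A) (hne : C ≠ D) :
    (∃ D' ∈ A, D' ≠ C ∧ ∃ v ∈ D, v ∉ C ∧ D' ⊆ insert v C) ∨
      ∃ D' ∈ A, D' ≠ D ∧ ∃ v ∈ C, v ∉ D ∧ D' ⊆ insert v D := by
  obtain ⟨L, hnd, hL, hquot⟩ := h
  have key : ∀ i j (hi : i < L.length) (hj : j < L.length) (C D : Finset (Fin g × Fin d)),
      j < i → L[i] = CoverMonomial K C → L[j] = CoverMonomial K D →
      ∃ D' ∈ A, D' ≠ C ∧ ∃ v ∈ D, v ∉ C ∧ D' ⊆ insert v C := by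
    intro i j hi hj C D hji hLC hLD
    have hmem (D' : Finset (Fin g × Fin d)) (hD' : CoverMonomial K D' ∈ L.take i) :
        D' ∈ A ∧ D' ≠ C := by
      constructor
      · have : CoverMonomial K D' ∈ CoverMonomial K '' A := hL ▸ List.mem_of_mem_take hD'
        obtain ⟨D'', hD'', he⟩ := this
        exact coverMonomial_injective he ▸ hD''
      · rintro rfl
        obtain ⟨k, hk, hLk⟩ := List.mem_take_iff_getElem.1 hD'
        have := (hnd.getElem_inj_iff).1 (hLk.trans hLC.symm)
        omega
    have himage : {u | u ∈ L.take i} =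
        CoverMonomial K '' {D' | CoverMonomial K D' ∈ L.take i} := by
      ext u
      constructor
      · intro hu
        have : u ∈ CoverMonomial K '' A := hL ▸ List.mem_of_mem_take hu
        obtain ⟨D'', hD'', rfl⟩ := this
        exact ⟨D'', hu, rfl⟩
      · rintro ⟨D'', hD'', rfl⟩
        exact hD''
    have hq := hquot i hi (by omega)
    rw [himage, List.get_eq_getElem, hLC, colon_eq_span_X_iff] at hq
    obtain ⟨D', hD', hv⟩ := hq D (List.mem_take_iff_getElem.2 ⟨j, by omega, hLD⟩)
    exact ⟨D', (hmem D' hD').1, (hmem D' hD').2, hv⟩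
  have hget (C : Finset (Fin g × Fin d)) (hC : C ∈ A) :
      ∃ i, ∃ hi : i < L.length, L[i] = CoverMonomial K C :=
    List.mem_iff_getElem.1 (show CoverMonomial K C ∈ {u | u ∈ L} from hL ▸ ⟨C, hC, rfl⟩)
  obtain ⟨i, hi, hLi⟩ := hget C hC
  obtain ⟨j, hj, hLj⟩ := hget D hD
  rcases lt_trichotomy i j with hij | rfl | hij
  · exact .inr (key j i hj hi D C hij hLj hLi)
  · exact absurd (coverMonomial_injective (hLi.symm.trans hLj)) hne
  · exact .inl (key i j hi hj C D hij hLi hLj)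

/-- A finite family of squarefree monomials satisfying the exchange property with respect to
an injective key into a linear order has linear quotients. -/
lemma hasLinearQuotients_of_key {σ κ : Type*} [LinearOrder κ] (F : Finset σ)
    (T : σ → Finset (Fin g × Fin d)) (hT : Function.Injective T)
    (key : σ → κ) (hkey : Function.Injective key)
    (h : ∀ t ∈ F, ∀ t' ∈ F, key t' < key t →
      ∃ t'' ∈ F, key t'' < key t ∧ ∃ v ∈ T t', v ∉ T t ∧ T t'' ⊆ insert v (T t)) :
    HasLinearQuotients (CoverMonomial K '' (T '' F)) := by
  classical
  let r : σ → σ → Prop := fun a b => key a ≤ key b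
  have : IsTrans σ r := ⟨fun _ _ _ => le_trans⟩
  have : Std.Antisymm r := ⟨fun _ _ h₁ h₂ => hkey (le_antisymm h₁ h₂)⟩
  have : Std.Total r := ⟨fun _ _ => le_total _ _⟩
  let l := F.sort r
  have hnd : l.Nodup := F.sort_nodup r
  have hlt : l.Pairwise fun a b => key a < key b :=
    (F.pairwise_sort r).imp₂ (fun a b (h₁ : key a ≤ key b) h₂ =>
      lt_of_le_of_ne h₁ (hkey.ne h₂)) hnd
  have htake (i : ℕ) (hi : i < l.length) (t : σ) :
      t ∈ l.take i ↔ t ∈ F ∧ key t < key l[i] := by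
    rw [List.pairwise_iff_getElem] at hlt
    rw [List.mem_take_iff_getElem, ← F.mem_sort r, List.mem_iff_getElem]
    constructor
    · rintro ⟨k, hk, rfl⟩
      exact ⟨⟨k, lt_of_lt_of_le hk (min_le_right _ _), rfl⟩, hlt _ _ _ _ (by omega)⟩
    · rintro ⟨⟨k, hk, rfl⟩, hki⟩
      refine ⟨k, ?_, rfl⟩
      have : k < i := by
        by_contra! hle
        rcases hle.lt_or_eq with h' | rfl
        · exact lt_asymm hki (hlt _ _ hi hk h')
        · exact lt_irrefl _ hki
      omega
  refine ⟨l.map (CoverMonomial K ∘ T), hnd.map (coverMonomial_injective.comp hT), ?_, ?_⟩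
  · ext u
    simp [l]
  · intro i hi _
    have hi' : i < l.length := by simpa using hi
    have himage : {u | u ∈ (l.map (CoverMonomial K ∘ T)).take i} =
        CoverMonomial K '' (T '' {t | t ∈ F ∧ key t < key l[i]}) := by
      ext u
      rw [← List.map_take, Set.mem_ofPred_eq, List.mem_map, Set.image_image]
      exact exists_congr fun t => and_congr_left fun _ => htake i hi' t
    rw [himage, List.get_eq_getElem, List.getElem_map, Function.comp_apply, colon_eq_span_X_iff]
    rintro _ ⟨t', ⟨ht'F, ht'⟩, rfl⟩
    have hlF : l[i] ∈ F := (F.mem_sort r).1 (List.getElem_mem hi')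
    obtain ⟨t'', ht''F, ht'', hv⟩ := h _ hlF t' ht'F ht'
    exact ⟨T t'', ⟨t'', ⟨ht''F, ht''⟩, rfl⟩, hv⟩

end Monomials

section Tuples

variable {d : ℕ} {E : Set (Fin d → Fin 4)}

lemma isCover_tupleCover_iff {a b c e : Fin d} :
    IsCover E (TupleCover a b c e) ↔
      ∀ f ∈ E, f a = 0 ∨ f b = 1 ∨ f c = 2 ∨ f e = 3 := by
  refine forall₂_congr fun f _ => ⟨?_, ?_⟩
  · rintro ⟨i, hi⟩
    simp only [TupleCover, Finset.mem_insert, Finset.mem_singleton, Prod.mk.injEq] at hi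
    rcases hi with ⟨h, rfl⟩ | ⟨h, rfl⟩ | ⟨h, rfl⟩ | ⟨h, rfl⟩ <;> simp [h]
  · rintro (h | h | h | h)
    exacts [⟨a, by simp [h, TupleCover]⟩, ⟨b, by simp [h, TupleCover]⟩,
      ⟨c, by simp [h, TupleCover]⟩, ⟨e, by simp [h, TupleCover]⟩]

/-- The color of the first vertex can be lowered in a cover. -/
lemma IsCover.lower_first (hmono : ∀ f ∈ E, Monotone f) {a b c e a' : Fin d}
    (h : IsCover E (TupleCover a b c e)) (ha : a' ≤ a) : IsCover E (TupleCover a' b c e) := by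
  rw [isCover_tupleCover_iff] at h ⊢
  intro f hf
  exact (h f hf).imp_left fun h0 => le_antisymm (h0 ▸ hmono f hf ha) (Fin.zero_le _)

/-- The color of the last vertex can be raised in a cover. -/
lemma IsCover.raise_last (hmono : ∀ f ∈ E, Monotone f) {a b c e e' : Fin d}
    (h : IsCover E (TupleCover a b c e)) (he : e ≤ e') : IsCover E (TupleCover a b c e') := by
  rw [isCover_tupleCover_iff] at h ⊢
  intro f hf
  refine (h f hf).imp_right fun h1 => h1.imp_right fun h2 => h2.imp_right fun h3 => ?_
  exact le_antisymm (Fin.le_last _) (h3 ▸ hmono f hf he)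

lemma card_tupleCover (a b c e : Fin d) : (TupleCover a b c e).card = 4 := by
  simp [TupleCover]

lemma IsCover.exists_tupleCover_subset (hconst : ∀ j : Fin 4, (fun _ : Fin d => j) ∈ E)
    {C : Finset (Fin 4 × Fin d)} (hC : IsCover E C) :
    ∃ a b c e, TupleCover a b c e ⊆ C := by
  choose t ht using fun j => hC _ (hconst j)
  refine ⟨t 0, t 1, t 2, t 3, ?_⟩
  simp [TupleCover, Finset.insert_subset_iff, ht]

lemma isMinCover_iff (hconst : ∀ j : Fin 4, (fun _ : Fin d => j) ∈ E)
    (hunmixed : ∀ C : Finset (Fin 4 × Fin d), IsMinCover E C → C.card = 4)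
    (C : Finset (Fin 4 × Fin d)) :
    IsMinCover E C ↔ ∃ a b c e, IsCover E (TupleCover a b c e) ∧ TupleCover a b c e = C := by
  constructor
  · intro hC
    obtain ⟨a, b, c, e, hsub⟩ := hC.1.exists_tupleCover_subset hconst
    have heq := Finset.eq_of_subset_of_card_le hsub
      (by rw [hunmixed C hC, card_tupleCover])
    exact ⟨a, b, c, e, heq ▸ hC.1, heq⟩
  · rintro ⟨a, b, c, e, hcov, rfl⟩
    refine ⟨hcov, fun C' hC' hcov' => ?_⟩
    obtain ⟨a', b', c', e', hsub⟩ := hcov'.exists_tupleCover_subset hconst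
    have h₁ := Finset.card_le_card hsub
    have h₂ := Finset.card_lt_card hC'
    rw [card_tupleCover] at h₁ h₂
    omega

open Classical in
/-- Two vertices of the second row with the same first and last vertices have comparable sets of
admissible completions in the third row, unless condition (*) holds. -/
lemma completions_subset_of_card_le
    (hstar : ¬ CondStar E) {a b e s : Fin d}
    (hcard : (Finset.univ.filter fun c => IsCover E (TupleCover a b c e)).card ≤
      (Finset.univ.filter fun c => IsCover E (TupleCover a s c e)).card)
    {c : Fin d} (hc : IsCover E (TupleCover a b c e)) : IsCover E (TupleCover a s c e) := by
  by_contra hsc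
  have hsub : (Finset.univ.filter fun c => IsCover E (TupleCover a s c e)) ⊆
      Finset.univ.filter fun c => IsCover E (TupleCover a b c e) := by
    intro t ht
    simp only [Finset.mem_filter, Finset.mem_univ, true_and] at ht ⊢
    by_contra hbt
    exact hstar ⟨a, b, c, e, s, t, hc, ht, hbt, hsc⟩
  have heq := Finset.eq_of_subset_of_card_le hsub hcard
  have : c ∈ Finset.univ.filter fun c => IsCover E (TupleCover a s c e) := by
    rw [heq]; simpa using hc
  exact hsc (by simpa using this)

end Tuples


/-- Theorem (height 4): for an unmixed uniform admissible clutter of height `g = 4`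
in the standard model, the Alexander dual ideal `I(𝒞)^∨` has linear quotients if and
only if the clutter does not satisfy condition (*). -/
theorem alexander_dual_linear_quotients_iff_not_condStar (d : ℕ) (hd : 0 < d)
    (K : Type*) [Field K]
    (E : Set (Fin d → Fin 4))
    (hmono : ∀ f ∈ E, Monotone f)
    (hconst : ∀ j : Fin 4, (fun _ : Fin d => j) ∈ E)
    (hunmixed : ∀ C : Finset (Fin 4 × Fin d), IsMinCover E C → C.card = 4) :
    HasLinearQuotients {u : MvPolynomial (Fin 4 × Fin d) K |
        ∃ C : Finset (Fin 4 × Fin d), IsMinCover E C ∧ u = CoverMonomial K C} ↔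
      ¬ CondStar E := by
  classical
  let T : Fin d × Fin d × Fin d × Fin d → Finset (Fin 4 × Fin d) :=
    fun t => TupleCover t.1 t.2.1 t.2.2.1 t.2.2.2
  let F : Finset (Fin d × Fin d × Fin d × Fin d) := Finset.univ.filter fun t => IsCover E (T t)
  have hT : Function.Injective T := by
    rintro ⟨a, b, c, e⟩ ⟨a', b', c', e'⟩ h
    have h' (j : Fin 4) (i : Fin d) := Finset.ext_iff.1 h (j, i)
    have h0 := h' 0 a
    have h1 := h' 1 b
    have h2 := h' 2 c
    have h3 := h' 3 e
    simp [T, TupleCover] at h0 h1 h2 h3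
    simp [h0, h1, h2, h3]
  have hgen : {u : MvPolynomial (Fin 4 × Fin d) K |
      ∃ C : Finset (Fin 4 × Fin d), IsMinCover E C ∧ u = CoverMonomial K C} =
      CoverMonomial K '' (T '' F) := by
    ext u
    simp [isMinCover_iff hconst hunmixed, F, T, eq_comm]
  rw [hgen]
  constructor
  · rintro hlin ⟨a, b, c, e, s, t, habce, haste, habte, hasce⟩
    have exchange : ∀ b c s t : Fin d, IsCover E (TupleCover a b c e) →
        ¬ IsCover E (TupleCover a b t e) → ¬ IsCover E (TupleCover a s c e) →
        ¬ ∃ D' ∈ T '' F, D' ≠ TupleCover a b c e ∧ ∃ v ∈ TupleCover a s t e,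
          v ∉ TupleCover a b c e ∧ D' ⊆ insert v (TupleCover a b c e) := by
      rintro b c s t habce habte hasce ⟨_, ⟨⟨a', b', c', e'⟩, hF, rfl⟩, hne, v, hv, hvC, hsub⟩
      have hcov : IsCover E (TupleCover a' b' c' e') := by simpa [F, T] using hF
      simp only [TupleCover, Finset.mem_insert, Finset.mem_singleton] at hv hvC
      rcases hv with rfl | rfl | rfl | rfl
      · simp at hvC
      · simp [T, TupleCover, Finset.insert_subset_iff] at hsub hne
        obtain ⟨rfl, rfl | rfl, rfl, rfl⟩ := hsub
        · exact hasce hcov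
        · simp at hne
      · simp [T, TupleCover, Finset.insert_subset_iff] at hsub hne
        obtain ⟨rfl, rfl, rfl | rfl, rfl⟩ := hsub
        · exact habte hcov
        · simp at hne
      · simp at hvC
    have hne : TupleCover a b c e ≠ TupleCover a s t e := by
      intro h
      have := hT (a₁ := (a, b, c, e)) (a₂ := (a, s, t, e)) h
      simp only [Prod.mk.injEq, and_true, true_and] at this
      exact hasce (this.1 ▸ habce)
    rcases hlin.exists_exchange (C := TupleCover a b c e) (D := TupleCover a s t e)
      ⟨(a, b, c, e), by simpa [F, T] using habce, rfl⟩
      ⟨(a, s, t, e), by simpa [F, T] using haste, rfl⟩ hne with h | h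
    · exact exchange b c s t habce habte hasce h
    · exact exchange s t b c haste hasce habte h
  · intro hstar
    let N : Fin d → Fin d → Fin d → ℕ := fun a e b =>
      (Finset.univ.filter fun c => IsCover E (TupleCover a b c e)).card
    let key : Fin d × Fin d × Fin d × Fin d →
        Fin d ×ₗ (Fin d)ᵒᵈ ×ₗ ℕᵒᵈ ×ₗ Fin d ×ₗ Fin d := fun t =>
      toLex (t.1, toLex (OrderDual.toDual t.2.2.2, toLex (OrderDual.toDual (N t.1 t.2.2.2 t.2.1),
        toLex (t.2.1, t.2.2.1))))
    have hkey : Function.Injective key := by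
      rintro ⟨a, b, c, e⟩ ⟨a', b', c', e'⟩ h
      simp only [key, EmbeddingLike.apply_eq_iff_eq, Prod.mk.injEq] at h
      simp [h]
    have key_lt (a b c e a' b' c' e' : Fin d) : key (a', b', c', e') < key (a, b, c, e) ↔
        a' < a ∨ a' = a ∧ (e < e' ∨ e' = e ∧ (N a e b < N a' e' b' ∨
          N a' e' b' = N a e b ∧ (b' < b ∨ b' = b ∧ c' < c))) := by
      simp [key, Prod.Lex.toLex_lt_toLex]
    refine hasLinearQuotients_of_key F T hT key hkey ?_
    rintro ⟨a, b, c, e⟩ hF ⟨a', b', c', e'⟩ hF' hlt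
    have hcov : IsCover E (TupleCover a b c e) := by simpa [F, T] using hF
    have hcov' : IsCover E (TupleCover a' b' c' e') := by simpa [F, T] using hF'
    have memF {a b c e : Fin d} (h : IsCover E (TupleCover a b c e)) : (a, b, c, e) ∈ F := by
      simpa [F, T] using h
    rw [key_lt] at hlt
    rcases hlt with ha | ⟨rfl, he | ⟨rfl, hbc⟩⟩
    · refine ⟨(a', b, c, e), memF (hcov.lower_first hmono ha.le), ?_, (0, a'), ?_⟩
      · exact (key_lt ..).2 (.inl ha)
      · simp [T, TupleCover, Finset.insert_subset_iff, ha.ne]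
    · refine ⟨(a', b, c, e'), memF (hcov.raise_last hmono he.le), ?_, (3, e'), ?_⟩
      · exact (key_lt ..).2 (.inr ⟨rfl, .inl he⟩)
      · simp [T, TupleCover, Finset.insert_subset_iff, he.ne']
    · by_cases hb : b' = b
      · subst hb
        have hc : c' < c := by simpa using hbc
        refine ⟨(a', b', c', e'), hF', (key_lt ..).2 (by simp [hc]), (2, c'), ?_⟩
        simp [T, TupleCover, Finset.insert_subset_iff, hc.ne]
      · have hN : N a' e' b ≤ N a' e' b' := by
          rcases hbc with h | h
          · exact h.le
          · exact h.1.ge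
        refine ⟨(a', b', c, e'), memF (completions_subset_of_card_le hstar hN hcov), ?_,
          (1, b'), ?_⟩
        · rw [key_lt]
          simpa [hb] using hbc
        · simp [T, TupleCover, Finset.insert_subset_iff, hb]
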